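/- (Well-behaved aggregation methods satisfy Antecedent Maximality and Weakest-Link Limiting.) Let (f,g) be a well-behaved aggregation method. Then: (i) for every real r with 0 ≤ r ≤ 1 and every list cs of admissible weighted argument trees with Str_{f,g} C = 1 for every C in cs, Str_{f,g} (node r cs) = r; and (ii) for every admissible weighted argument tree A and every element b of basis A, Str_{f,g} A ≤ b. -/

import Mathlib

/-- A weighted argument tree: a leaf states a premise with a weight,
a node applies an inference rule with a weight to a list of antecedent trees. -/
inductive T where
  | leaf : ℝ → T
  | node : ℝ → List T → T

/-- The multiset of all weights occurring in a tree. -/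
def basis : T → Multiset ℝ
  | .leaf w => {w}
  | .node r cs => r ::ₘ (cs.attach.map (fun c => basis c.1)).sum
decreasing_by
  have := List.sizeOf_lt_of_mem c.2
  simp only [T.node.sizeOf_spec]
  omega

/-- A tree is admissible if every weight in its basis lies in [0,1]. -/
def admissible (A : T) : Prop := ∀ b ∈ basis A, b ∈ Set.Icc (0:ℝ) 1

/-- The (f,g)-strength of a weighted argument tree: g aggregates the strengths of
the antecedents and f combines the rule/premise weight with that aggregate. -/
def Str (f : ℝ → ℝ → ℝ) (g : List ℝ → ℝ) : T → ℝ
  | .leaf w => f w (g [])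
  | .node r cs => f r (g (cs.attach.map (fun c => Str f g c.1)))
decreasing_by
  have := List.sizeOf_lt_of_mem c.2
  simp only [T.node.sizeOf_spec]
  omega

/-- A well-behaved aggregation method. -/
structure WellBehaved (f : ℝ → ℝ → ℝ) (g : List ℝ → ℝ) : Prop where
  f_mem : ∀ x ∈ Set.Icc (0:ℝ) 1, ∀ y ∈ Set.Icc (0:ℝ) 1, f x y ∈ Set.Icc (0:ℝ) 1
  g_mem : ∀ l : List ℝ, (∀ x ∈ l, x ∈ Set.Icc (0:ℝ) 1) → g l ∈ Set.Icc (0:ℝ) 1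
  g_perm : ∀ l l' : List ℝ, l.Perm l' → g l = g l'
  f_mono_left : ∀ x x' y : ℝ, x ∈ Set.Icc (0:ℝ) 1 → x' ∈ Set.Icc (0:ℝ) 1 →
    y ∈ Set.Icc (0:ℝ) 1 → x ≠ 0 → y ≠ 0 → x ≤ x' → f x y ≤ f x' y
  f_mono_right : ∀ x y y' : ℝ, x ∈ Set.Icc (0:ℝ) 1 → y ∈ Set.Icc (0:ℝ) 1 →
    y' ∈ Set.Icc (0:ℝ) 1 → x ≠ 0 → y ≠ 0 → y ≤ y' → f x y ≤ f x y'
  f_zero_left : ∀ x ∈ Set.Icc (0:ℝ) 1, f 0 x = 0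
  f_zero_right : ∀ x ∈ Set.Icc (0:ℝ) 1, f x 0 = 0
  f_one_right : ∀ x ∈ Set.Icc (0:ℝ) 1, f x 1 = x
  f_one_left : ∀ x ∈ Set.Icc (0:ℝ) 1, f 1 x = x
  g_nil : g [] = 1
  g_single : ∀ x ∈ Set.Icc (0:ℝ) 1, g [x] = x
  g_zero : ∀ l : List ℝ, (∀ x ∈ l, x ∈ Set.Icc (0:ℝ) 1) → g (l ++ [0]) = 0
  g_one : ∀ l : List ℝ, (∀ x ∈ l, x ∈ Set.Icc (0:ℝ) 1) → g (l ++ [1]) = g l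
  g_mono : ∀ l : List ℝ, (∀ x ∈ l, x ∈ Set.Icc (0:ℝ) 1) →
    ∀ y z : ℝ, y ∈ Set.Icc (0:ℝ) 1 → z ∈ Set.Icc (0:ℝ) 1 → y ≤ z →
      g (l ++ [y]) ≤ g (l ++ [z])

theorem basis_leaf (w : ℝ) : basis (T.leaf w) = {w} := by
  rw [basis]

theorem basis_node (r : ℝ) (cs : List T) :
    basis (T.node r cs) = r ::ₘ (cs.map basis).sum := by
  rw [basis, List.attach_map_val]

theorem Str_leaf (f : ℝ → ℝ → ℝ) (g : List ℝ → ℝ) (w : ℝ) :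
    Str f g (T.leaf w) = f w (g []) := by
  rw [Str]

theorem Str_node (f : ℝ → ℝ → ℝ) (g : List ℝ → ℝ) (r : ℝ) (cs : List T) :
    Str f g (T.node r cs) = f r (g (cs.map (Str f g))) := by
  rw [Str, List.attach_map_val]

theorem mem_basis_node {b r : ℝ} {cs : List T} :
    b ∈ basis (T.node r cs) ↔ b = r ∨ ∃ C ∈ cs, b ∈ basis C := by
  have mem_sum : b ∈ (cs.map basis).sum ↔ ∃ C ∈ cs, b ∈ basis C := by
    induction cs with
    | nil => simp
    | cons C cs ih => simp [ih]
  rw [basis_node, Multiset.mem_cons, mem_sum]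

theorem admissible_node {r : ℝ} {cs : List T} :
    admissible (T.node r cs) ↔ r ∈ Set.Icc (0:ℝ) 1 ∧ ∀ C ∈ cs, admissible C := by
  simp only [admissible, mem_basis_node]
  grind

namespace T

theorem induction_on_mem {motive : T → Prop} (leaf : ∀ w, motive (T.leaf w))
    (node : ∀ r cs, (∀ C ∈ cs, motive C) → motive (T.node r cs)) : ∀ A, motive A
  | .leaf w => leaf w
  | .node r cs => node r cs fun C _ => induction_on_mem leaf node C

end T

namespace WellBehaved

variable {f : ℝ → ℝ → ℝ} {g : List ℝ → ℝ}

theorem f_le_left (hwb : WellBehaved f g) {x y : ℝ} (hx : x ∈ Set.Icc (0:ℝ) 1)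
    (hy : y ∈ Set.Icc (0:ℝ) 1) : f x y ≤ x := by
  rcases eq_or_ne x 0 with rfl | hx0
  · exact (hwb.f_zero_left y hy).le
  rcases eq_or_ne y 0 with rfl | hy0
  · exact (hwb.f_zero_right x hx).trans_le hx.1
  · exact (hwb.f_mono_right x y 1 hx hy (by simp) hx0 hy0 hy.2).trans_eq (hwb.f_one_right x hx)

theorem f_le_right (hwb : WellBehaved f g) {x y : ℝ} (hx : x ∈ Set.Icc (0:ℝ) 1)
    (hy : y ∈ Set.Icc (0:ℝ) 1) : f x y ≤ y := by
  rcases eq_or_ne x 0 with rfl | hx0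
  · exact (hwb.f_zero_left y hy).trans_le hy.1
  rcases eq_or_ne y 0 with rfl | hy0
  · exact (hwb.f_zero_right x hx).le
  · exact (hwb.f_mono_left x 1 y hx (by simp) hy hx0 hy0 hx.2).trans_eq (hwb.f_one_left y hy)

theorem g_cons_le (hwb : WellBehaved f g) {a : ℝ} {l : List ℝ} (ha : a ∈ Set.Icc (0:ℝ) 1)
    (hl : ∀ x ∈ l, x ∈ Set.Icc (0:ℝ) 1) : g (a :: l) ≤ g l :=
  calc g (a :: l) = g (l ++ [a]) := hwb.g_perm _ _ (List.perm_append_singleton a l).symm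
    _ ≤ g (l ++ [1]) := hwb.g_mono l hl a 1 ha (by simp) ha.2
    _ = g l := hwb.g_one l hl

theorem g_append_singleton_le (hwb : WellBehaved f g) {x : ℝ} {l : List ℝ}
    (hx : x ∈ Set.Icc (0:ℝ) 1) (hl : ∀ y ∈ l, y ∈ Set.Icc (0:ℝ) 1) : g (l ++ [x]) ≤ x := by
  induction l with
  | nil => exact (hwb.g_single x hx).le
  | cons a l ih =>
    obtain ⟨ha, hl⟩ := List.forall_mem_cons.1 hl
    refine (hwb.g_cons_le ha fun y hy => ?_).trans (ih hl)
    rcases List.mem_append.1 hy with hy | hy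
    · exact hl y hy
    · rwa [List.mem_singleton.1 hy]

theorem g_le_of_mem (hwb : WellBehaved f g) {x : ℝ} {l : List ℝ}
    (hl : ∀ y ∈ l, y ∈ Set.Icc (0:ℝ) 1) (hx : x ∈ l) : g l ≤ x := by
  rw [hwb.g_perm l (l.erase x ++ [x])
    ((List.perm_cons_erase hx).trans (List.perm_append_singleton x _).symm)]
  exact hwb.g_append_singleton_le (hl x hx) fun y hy => hl y (List.mem_of_mem_erase hy)

theorem g_eq_one (hwb : WellBehaved f g) {l : List ℝ} (hl : ∀ x ∈ l, x = 1) : g l = 1 := by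
  induction l with
  | nil => exact hwb.g_nil
  | cons a l ih =>
    obtain ⟨rfl, htail⟩ := List.forall_mem_cons.1 hl
    rw [hwb.g_perm _ _ (List.perm_append_singleton 1 l).symm,
      hwb.g_one l fun x hx => by simp [htail x hx], ih htail]

theorem Str_mem (hwb : WellBehaved f g) (A : T) (hA : admissible A) :
    Str f g A ∈ Set.Icc (0:ℝ) 1 := by
  induction A using T.induction_on_mem with
  | leaf w =>
    rw [Str_leaf]
    exact hwb.f_mem w (hA w (by simp [basis_leaf])) _ (hwb.g_mem [] (by simp))
  | node r cs ih =>
    obtain ⟨hr, hcs⟩ := admissible_node.1 hA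
    rw [Str_node]
    exact hwb.f_mem r hr _
      (hwb.g_mem _ (List.forall_mem_map.2 fun C hC => ih C hC (hcs C hC)))

theorem Str_le_of_mem_basis (hwb : WellBehaved f g) (A : T) (hA : admissible A) {b : ℝ}
    (hb : b ∈ basis A) : Str f g A ≤ b := by
  induction A using T.induction_on_mem with
  | leaf w =>
    have hw : w ∈ Set.Icc (0:ℝ) 1 := hA w (by simp [basis_leaf])
    rw [basis_leaf, Multiset.mem_singleton] at hb
    rw [Str_leaf, hb]
    exact hwb.f_le_left hw (hwb.g_mem [] (by simp))
  | node r cs ih =>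
    obtain ⟨hr, hcs⟩ := admissible_node.1 hA
    have hl : ∀ x ∈ cs.map (Str f g), x ∈ Set.Icc (0:ℝ) 1 :=
      List.forall_mem_map.2 fun C hC => hwb.Str_mem C (hcs C hC)
    rw [Str_node]
    rcases mem_basis_node.1 hb with rfl | ⟨C, hC, hbC⟩
    · exact hwb.f_le_left hr (hwb.g_mem _ hl)
    · exact (hwb.f_le_right hr (hwb.g_mem _ hl)).trans <|
        (hwb.g_le_of_mem hl (List.mem_map_of_mem hC)).trans (ih C hC (hcs C hC) hbC)

end WellBehaved

theorem wellBehaved_antecedentMaximality_and_weakestLinkLimiting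
    (f : ℝ → ℝ → ℝ) (g : List ℝ → ℝ) (hwb : WellBehaved f g) :
    (∀ r : ℝ, 0 ≤ r → r ≤ 1 → ∀ cs : List T, (∀ C ∈ cs, admissible C) →
      (∀ C ∈ cs, Str f g C = 1) → Str f g (T.node r cs) = r) ∧
    (∀ A : T, admissible A → ∀ b ∈ basis A, Str f g A ≤ b) := by
  refine ⟨fun r hr0 hr1 cs _ hcs => ?_, fun A hA b hb => hwb.Str_le_of_mem_basis A hA hb⟩
  rw [Str_node, hwb.g_eq_one (List.forall_mem_map.2 hcs), hwb.f_one_right r ⟨hr0, hr1⟩]
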